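/- (Remark: Algorithm 1 implements a choice rule.) For every nonempty finite set B of alternatives, the set of acceptable alternatives satisfies Λ(B) ⊆ B and Λ(B) is nonempty. -/

import Mathlib

/-- `better v x y` iff some criterion `i` favors `x` over `y` (`v i x < v i y`)
and all higher-priority criteria `j > i` are ties. -/
def better {X I : Type*} [LinearOrder I] (v : I → X → ℝ) (x y : X) : Prop :=
  ∃ i : I, v i x < v i y ∧ ∀ j : I, i < j → v j x = v j y

/-- The set of acceptable alternatives `Λ(B)` computed by Algorithm 1 from the
decision rules DR1 and DR2. -/
def acceptable {X I : Type*} [LinearOrder I] (v : I → X → ℝ) (B : Finset X) :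
    Set X :=
  if B.card = 1 then ↑B
  else
    {w | w ∈ B ∧
      ((∃ y ∈ B, better v w y) ∧ (∀ z ∈ B, ¬ better v z w) ∨
        ∃ y ∈ B, y ≠ w ∧ ¬ better v w y ∧ ¬ better v y w ∧
          ∀ z ∈ B, ¬ (better v z w ∨ better v z y))}

theorem better_irrefl {X I : Type*} [LinearOrder I] (v : I → X → ℝ) (x : X) :
    ¬ better v x x := fun ⟨_, h, _⟩ => lt_irrefl _ h

theorem better_trans {X I : Type*} [LinearOrder I] {v : I → X → ℝ} {x y z : X}
    (hxy : better v x y) (hyz : better v y z) : better v x z := by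
  obtain ⟨i, hi, hi'⟩ := hxy
  obtain ⟨j, hj, hj'⟩ := hyz
  rcases lt_trichotomy i j with h | rfl | h
  · exact ⟨j, (hi' j h).trans_lt hj, fun k hk => (hi' k (h.trans hk)).trans (hj' k hk)⟩
  · exact ⟨i, hi.trans hj, fun k hk => (hi' k hk).trans (hj' k hk)⟩
  · exact ⟨i, hi.trans_eq (hj' i h), fun k hk => (hi' k hk).trans (hj' k (h.trans hk))⟩

/-- With finitely many criteria, incomparable alternatives have the same attributes. -/
theorem attributes_eq_of_not_better {X I : Type*} [LinearOrder I] [Finite I]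
    {v : I → X → ℝ} {x y : X} (hxy : ¬ better v x y) (hyx : ¬ better v y x) (i : I) :
    v i x = v i y := by
  induction i using (wellFounded_gt (α := I)).induction with
  | _ i ih =>
    rcases lt_trichotomy (v i x) (v i y) with h | h | h
    · exact (hxy ⟨i, h, ih⟩).elim
    · exact h
    · exact (hyx ⟨i, h, fun j hj => (ih j hj).symm⟩).elim

theorem exists_forall_not_better {X I : Type*} [LinearOrder I] (v : I → X → ℝ)
    {B : Finset X} (hB : B.Nonempty) : ∃ w ∈ B, ∀ z ∈ B, ¬ better v z w := by
  have : IsStrictOrder X (better v) :=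
    { irrefl := better_irrefl v, trans := fun _ _ _ => better_trans }
  obtain ⟨b, hb⟩ := hB
  obtain ⟨w, -, hw⟩ := (B.finite_toSet.wellFoundedOn (r := better v)).has_min
    Set.univ ⟨⟨b, hb⟩, trivial⟩
  exact ⟨w, w.2, fun z hz => hw ⟨z, hz⟩ trivial⟩

/-- Algorithm 1 implements a choice rule: for every nonempty finite choice
experiment `B`, `Λ(B) ⊆ B` and `Λ(B)` is nonempty. -/
theorem acceptable_is_choice_rule {X I : Type*} [LinearOrder I] [Fintype I]
    (v : I → X → ℝ) (B : Finset X) (hB : B.Nonempty) :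
    acceptable v B ⊆ ↑B ∧ (acceptable v B).Nonempty := by
  unfold acceptable
  split_ifs with hcard
  · exact ⟨subset_rfl, hB⟩
  refine ⟨fun w hw => hw.1, ?_⟩
  obtain ⟨w, hw, hmin⟩ := exists_forall_not_better v hB
  have hnt : B.Nontrivial := Finset.one_lt_card_iff_nontrivial.mp
    (lt_of_le_of_ne hB.card_pos (Ne.symm hcard))
  obtain ⟨y, hy, hyw⟩ := hnt.exists_ne w
  refine ⟨w, hw, ?_⟩
  by_cases hwy : better v w y
  · exact Or.inl ⟨⟨y, hy, hwy⟩, hmin⟩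
  · refine Or.inr ⟨y, hy, hyw, hwy, hmin y hy, fun z hz h => ?_⟩
    rcases h with h | ⟨i, hi, hi'⟩
    · exact hmin z hz h
    · have heq := attributes_eq_of_not_better hwy (hmin y hy)
      exact hmin z hz ⟨i, hi.trans_eq (heq i).symm, fun j hj => (hi' j hj).trans (heq j).symm⟩
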